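/- Let R be a Noetherian commutative ring such that the localization R_p is a regular local ring for every prime ideal p, let I ⊆ R be an ideal, and let p be a prime ideal containing I such that (R/I)_p is not a regular local ring. Then there exists a finitely generated R/I-module M such that M_p has infinite projective dimension over (R/I)_p and M has finite projective dimension over R. -/

import Mathlib

open CategoryTheory

/-- A module `M` over a ring `A` has finite projective dimension iff it admits a
projective resolution which vanishes in all sufficiently large degrees. -/
def HasFinProjDim (A : Type) [Ring A] (M : Type) [AddCommGroup M] [Module A M] : Prop :=
  ∃ (P : ProjectiveResolution (ModuleCat.of A M)) (n : ℕ),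
    ∀ m : ℕ, n < m → Limits.IsZero (P.complex.X m)

/-- A commutative ring is a regular local ring if it is Noetherian local and its
embedding dimension (the dimension of the cotangent space `m/m²` over the residue
field) equals its Krull dimension. -/
def IsRegLocal (A : Type) [CommRing A] : Prop :=
  ∃ (_ : IsLocalRing A), IsNoetherianRing A ∧
    ((Module.finrank (IsLocalRing.ResidueField A) (IsLocalRing.CotangentSpace A) :
        WithBot ℕ∞) = ringKrullDim A)

/-- The image in `R/I` of the complement of a prime `p` of `R`; localizing `R/I`
at this submonoid gives the localization of `R/I` at the prime `p/I`. -/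
abbrev imageSubmonoidI (R : Type) [CommRing R] (I : Ideal R) (p : Ideal R) [p.IsPrime] :
    Submonoid (R ⧸ I) :=
  Submonoid.map (Ideal.Quotient.mk I) p.primeCompl

namespace CategoryTheory

open Limits Abelian

universe v u

variable {C : Type u} [Category.{v} C] [Abelian C]

lemma ProjectiveResolution.hasProjectiveDimensionLT [EnoughProjectives C] {X : C}
    (P : ProjectiveResolution X) (n : ℕ) (h : ∀ m, n ≤ m → IsZero (P.complex.X m)) :
    HasProjectiveDimensionLT X n := by
  let := HasExt.standard C
  rw [hasProjectiveDimensionLT_iff]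
  intro i hi Y e
  obtain ⟨f, hf, rfl⟩ := P.extMk_surjective e (i + 1) rfl
  obtain rfl : f = 0 := (h i hi).eq_of_src _ _
  simp

/-- The projective resolution given by an exact augmented complex of projective objects. -/
noncomputable def ProjectiveResolution.ofExact {X : C} (K : ChainComplex C ℕ) (ε : K.X 0 ⟶ X)
    [Epi ε] (w : K.d 1 0 ≫ ε = 0) (hproj : ∀ n, Projective (K.X n))
    (h₀ : (ShortComplex.mk _ _ w).Exact) (h : ∀ n, K.ExactAt (n + 1)) :
    ProjectiveResolution X where
  complex := K
  projective := hproj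
  π := (ChainComplex.toSingle₀Equiv _ _).symm ⟨ε, w⟩
  quasiIso := ⟨fun n => by
    cases n with
    | zero =>
      rw [ChainComplex.quasiIsoAt₀_iff, ShortComplex.quasiIso_iff_of_zeros']
      · have key (g : K.X 0 ⟶ X) (hg : g = ε) (w' : K.d 1 0 ≫ g = 0) :
            (ShortComplex.mk _ _ w').Exact ∧ Epi g := by
          subst hg
          exact ⟨h₀, inferInstance⟩
        exact key _ (ChainComplex.toSingle₀Equiv_symm_apply_f_zero ε w) _
      all_goals first | rfl | exact K.shape _ _ (by simp)
    | succ n =>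
      rw [quasiIsoAt_iff_exactAt']
      · exact h n
      · apply ChainComplex.exactAt_succ_single_obj⟩

lemma exists_exact_complex_of_hasProjectiveDimensionLE [EnoughProjectives C] (n : ℕ)
    (X : C) [HasProjectiveDimensionLE X n] :
    ∃ (K : ChainComplex C ℕ) (ε : K.X 0 ⟶ X) (w : K.d 1 0 ≫ ε = 0), Epi ε ∧
      (∀ m, Projective (K.X m)) ∧ (ShortComplex.mk _ _ w).Exact ∧ (∀ m, K.ExactAt (m + 1)) ∧
      ∀ m, n < m → IsZero (K.X m) := by
  induction n generalizing X with
  | zero =>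
    have : Projective X := (projective_iff_hasProjectiveDimensionLE_zero X).mpr ‹_›
    have hzero (m : ℕ) (hm : 0 < m) : IsZero (((ChainComplex.single₀ C).obj X).X m) :=
      HomologicalComplex.isZero_single_obj_X _ _ _ _ (by lia)
    have hmono : Mono (𝟙 X) := inferInstance
    have hepi : Epi (𝟙 X) := inferInstance
    refine ⟨(ChainComplex.single₀ C).obj X, 𝟙 X, (hzero 1 one_pos).eq_of_src _ _, hepi,
      (ProjectiveResolution.self X).projective, ?_,
      fun m ↦ ChainComplex.exactAt_succ_single_obj _ _, hzero⟩
    exact (ShortComplex.exact_iff_mono _ ((hzero 1 one_pos).eq_of_src _ _)).mpr hmono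
  | succ n ih =>
    let S := ShortComplex.mk _ _ (kernel.condition (Projective.π X))
    have hS : S.ShortExact := { exact := ShortComplex.exact_kernel _ }
    have : HasProjectiveDimensionLE S.X₁ n :=
      (hS.hasProjectiveDimensionLT_X₃_iff n inferInstance).mp ‹_›
    obtain ⟨K, ε, w, hε, hproj, h₀, h, hzero⟩ := ih S.X₁
    have hfg : (ε ≫ S.f) ≫ S.g = 0 := by simp
    refine ⟨K.augment (ε ≫ S.f) (by rw [← Category.assoc, w, zero_comp]), S.g,
      hfg, hS.epi_g, ?_, ?_, ?_, ?_⟩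
    · rintro (_ | m)
      · exact inferInstanceAs (Projective (Projective.over X))
      · exact hproj m
    · have : (ShortComplex.mk (ε ≫ S.f) S.g hfg).Exact := by
        let φ : ShortComplex.mk (ε ≫ S.f) S.g hfg ⟶ S :=
          { τ₁ := ε, τ₂ := 𝟙 _, τ₃ := 𝟙 _ }
        have : Epi φ.τ₁ := hε
        exact (ShortComplex.exact_iff_of_epi_of_isIso_of_mono φ).mpr hS.exact
      exact this
    · intro m
      rw [HomologicalComplex.exactAt_iff' _ (m + 2) (m + 1) m (by simp) (by simp)]
      cases m with
      | zero =>
        have : (ShortComplex.mk (K.d 1 0) (ε ≫ S.f)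
            (by rw [← Category.assoc, w, zero_comp])).Exact := by
          let φ : ShortComplex.mk (K.d 1 0) ε w ⟶
              ShortComplex.mk (K.d 1 0) (ε ≫ S.f) (by rw [← Category.assoc, w, zero_comp]) :=
            { τ₁ := 𝟙 _, τ₂ := 𝟙 _, τ₃ := S.f }
          have : Mono φ.τ₃ := hS.mono_f
          exact (ShortComplex.exact_iff_of_epi_of_isIso_of_mono φ).mp h₀
        exact this
      | succ m =>
        exact (HomologicalComplex.exactAt_iff' _ (m + 2) (m + 1) m (by simp) (by simp)).mp (h m)
    · rintro (_ | m) hm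
      · simp at hm
      · exact hzero m (by lia)

end CategoryTheory

lemma hasFinProjDim_iff {A : Type} [Ring A] {M : Type} [AddCommGroup M] [Module A M] :
    HasFinProjDim A M ↔ ∃ n, HasProjectiveDimensionLE (ModuleCat.of A M) n := by
  refine ⟨fun ⟨P, n, hP⟩ ↦ ⟨n, P.hasProjectiveDimensionLT (n + 1) hP⟩, fun ⟨n, _⟩ ↦ ?_⟩
  obtain ⟨K, ε, w, _, hproj, h₀, h, hzero⟩ :=
    exists_exact_complex_of_hasProjectiveDimensionLE n (ModuleCat.of A M)
  exact ⟨.ofExact K ε w hproj h₀ h, n, hzero⟩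

universe u

open IsLocalRing TensorProduct

lemma LinearMap.shortExact_subtype_ker {A F M : Type u} [CommRing A] [AddCommGroup F]
    [Module A F] [AddCommGroup M] [Module A M] (g : F →ₗ[A] M) (hg : Function.Surjective g) :
    (ModuleCat.shortComplexOfCompEqZero (LinearMap.ker g).subtype g
      (by ext x; exact x.2)).ShortExact :=
  ModuleCat.shortComplex_shortExact _ (LinearMap.exact_subtype_ker_map g)
    (Submodule.injective_subtype _) hg

lemma hasProjectiveDimensionLE_ker_iff {A F M : Type u} [CommRing A] [AddCommGroup F]
    [Module A F] [Module.Projective A F] [AddCommGroup M] [Module A M] (g : F →ₗ[A] M)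
    (hg : Function.Surjective g) (n : ℕ) :
    HasProjectiveDimensionLE (ModuleCat.of A (LinearMap.ker g)) n ↔
      HasProjectiveDimensionLE (ModuleCat.of A M) (n + 1) :=
  ((g.shortExact_subtype_ker hg).hasProjectiveDimensionLT_X₃_iff n
    ((IsProjective.iff_projective F).mp inferInstance)).symm

lemma hasProjectiveDimensionLE_zero_iff {A M : Type u} [CommRing A] [AddCommGroup M]
    [Module A M] : HasProjectiveDimensionLE (ModuleCat.of A M) 0 ↔ Module.Projective A M := by
  rw [← projective_iff_hasProjectiveDimensionLE_zero, IsProjective.iff_projective M]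

/-- A finite module over a local ring admits a minimal free cover. -/
lemma IsLocalRing.exists_surjective_ker_apply_mem_maximalIdeal (A M : Type u) [CommRing A] [IsLocalRing A]
    [AddCommGroup M] [Module A M] [Module.Finite A M] :
    ∃ (ι : Type u) (_ : Finite ι) (g : (ι →₀ A) →ₗ[A] M), Function.Surjective g ∧
      ∀ x ∈ LinearMap.ker g, ∀ i, x i ∈ maximalIdeal A := by
  let b := Module.Free.chooseBasis (ResidueField A) (ResidueField A ⊗[A] M)
  have hs : Function.Surjective (TensorProduct.mk A (ResidueField A) M 1) :=
    TensorProduct.mk_surjective A M _ residue_surjective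
  choose v hv using fun i => hs (b i)
  refine ⟨_, inferInstance, Finsupp.linearCombination A v, ?_, fun x hx i => ?_⟩
  · rw [← LinearMap.range_eq_top, Finsupp.range_linearCombination]
    exact span_eq_top_of_tmul_eq_basis v b hv
  · have h : Finsupp.linearCombination (ResidueField A) b
        (x.mapRange (residue A) (map_zero _)) = 0 := by
      have := congrArg (TensorProduct.mk A (ResidueField A) M 1) (LinearMap.mem_ker.mp hx)
      rw [map_zero, Finsupp.linearCombination_apply, Finsupp.sum, map_sum] at this
      rw [Finsupp.linearCombination_apply, Finsupp.sum_mapRange_index (by simp), Finsupp.sum]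
      rw [← this]
      refine Finset.sum_congr rfl fun i _ => ?_
      rw [map_smul, hv, ← algebraMap_smul (ResidueField A) (x i) (b i)]
      rfl
    have h' := DFunLike.congr_fun (linearIndependent_iff.mp b.linearIndependent _ h) i
    rw [← residue_eq_zero_iff]
    simpa using h'

/-- Over a Noetherian local ring of depth zero, a finite module of finite projective dimension is
free. -/
lemma IsLocalRing.free_of_hasProjectiveDimensionLE {A : Type u} [CommRing A] [IsLocalRing A]
    [IsNoetherianRing A] {a : A} (ha : a ≠ 0) (hma : ∀ y ∈ maximalIdeal A, a * y = 0) (n : ℕ)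
    (M : Type u) [AddCommGroup M] [Module A M] [Module.Finite A M]
    (h : HasProjectiveDimensionLE (ModuleCat.of A M) n) : Module.Free A M := by
  induction n generalizing M with
  | zero =>
    have := hasProjectiveDimensionLE_zero_iff.mp h
    exact Module.free_of_flat_of_isLocalRing
  | succ n ih =>
    obtain ⟨ι, _, g, hg, hker⟩ := exists_surjective_ker_apply_mem_maximalIdeal A M
    have hfree := ih _ ((hasProjectiveDimensionLE_ker_iff g hg n).mpr h)
    have hbot : Subsingleton (LinearMap.ker g) := by
      by_contra hne
      rw [not_subsingleton_iff_nontrivial] at hne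
      refine ha ?_
      have hmem : a ∈ Module.annihilator A (LinearMap.ker g) := by
        rw [Module.mem_annihilator]
        intro x
        ext i
        exact hma _ (hker x x.2 i)
      rwa [(Module.annihilator_eq_bot (R := A) (M := LinearMap.ker g)).mpr inferInstance] at hmem
    refine Module.Free.of_equiv (LinearEquiv.ofBijective g ⟨?_, hg⟩)
    exact LinearMap.ker_eq_bot.mp (Submodule.subsingleton_iff_eq_bot.mp hbot)

/-- Reduction modulo an element which is regular on both the ring and the module does not increase
the projective dimension. -/
lemma hasProjectiveDimensionLE_quotSMulTop {A : Type u} [CommRing A] {x : A}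
    (hx : IsSMulRegular A x) (n : ℕ) (M : Type u) [AddCommGroup M] [Module A M]
    (hxM : IsSMulRegular M x) (h : HasProjectiveDimensionLE (ModuleCat.of A M) n) :
    HasProjectiveDimensionLE (ModuleCat.of (A ⧸ Ideal.span {x}) (QuotSMulTop x M)) n := by
  induction n generalizing M with
  | zero =>
    rw [hasProjectiveDimensionLE_zero_iff] at h ⊢
    exact Module.Projective.of_equiv ((QuotSMulTop.equivQuotTensor x M).extendScalarsOfSurjective
      Ideal.Quotient.mk_surjective).symm
  | succ n ih =>
    let g : (M →₀ A) →ₗ[A] M := Finsupp.linearCombination A id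
    have hg : Function.Surjective g := Finsupp.linearCombination_id_surjective A M
    have hK := ih _ ((hx.finsupp (α := M)).submodule (LinearMap.ker g) x)
      ((hasProjectiveDimensionLE_ker_iff g hg n).mpr h)
    let φ := (QuotSMulTop.map (M := LinearMap.ker g) x
      (LinearMap.ker g).subtype).extendScalarsOfSurjective
      (Ideal.Quotient.mk_surjective (I := Ideal.span {x}))
    let ψ := (QuotSMulTop.map x g).extendScalarsOfSurjective
      (Ideal.Quotient.mk_surjective (I := Ideal.span {x}))
    have hexact : Function.Exact φ ψ :=
      QuotSMulTop.map_exact x (LinearMap.exact_subtype_ker_map g) hg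
    have hinj : Function.Injective φ := by
      have h0 : Function.Exact (0 : LinearMap.ker g →ₗ[A] LinearMap.ker g)
          (LinearMap.ker g).subtype :=
        (LinearMap.exact_zero_iff_injective _ _).mpr (Submodule.injective_subtype _)
      have := QuotSMulTop.map_first_exact_on_four_term_exact_of_isSMulRegular_last
        (M := LinearMap.ker g) (M' := LinearMap.ker g) h0
        (LinearMap.exact_subtype_ker_map g) hxM
      rw [map_zero] at this
      exact (LinearMap.exact_zero_iff_injective _ _).mp this
    refine ((ModuleCat.shortComplex_shortExact (ModuleCat.shortComplexOfCompEqZero φ ψ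
      hexact.linearMap_comp_eq_zero) hexact hinj
      (QuotSMulTop.map_surjective x hg)).hasProjectiveDimensionLT_X₃_iff n ?_).mpr hK
    exact (IsProjective.iff_projective (R := A ⧸ Ideal.span {x}) (QuotSMulTop x (M →₀ A))).mp
      inferInstance

/-- The first change of rings theorem. -/
lemma hasProjectiveDimensionLE_of_quotient {A : Type u} [CommRing A] {x : A}
    (hx : IsSMulRegular A x) (n : ℕ) (N : Type u) [AddCommGroup N] [Module A N]
    [Module (A ⧸ Ideal.span {x}) N] [IsScalarTower A (A ⧸ Ideal.span {x}) N]
    (h : HasProjectiveDimensionLE (ModuleCat.of (A ⧸ Ideal.span {x}) N) n) :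
    HasProjectiveDimensionLE (ModuleCat.of A N) (n + 1) := by
  let B := A ⧸ Ideal.span {x}
  have hfree (ι : Type u) : HasProjectiveDimensionLE (ModuleCat.of A (ι →₀ B)) 1 := by
    let g : (ι →₀ A) →ₗ[A] (ι →₀ B) := Finsupp.mapRange.linearMap (Submodule.mkQ (Ideal.span {x}))
    have hg : Function.Surjective g :=
      Finsupp.mapRange_surjective _ rfl (Submodule.mkQ_surjective (Ideal.span {x}))
    let f : (ι →₀ A) →ₗ[A] (ι →₀ A) := LinearMap.lsmul A _ x
    have hexact : Function.Exact f g := by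
      rw [LinearMap.exact_iff]
      ext y
      have hker : y ∈ LinearMap.ker g ↔ ∀ i, y i ∈ Ideal.span {x} := by
        rw [LinearMap.mem_ker, Finsupp.ext_iff]
        exact forall_congr' fun i => Submodule.Quotient.mk_eq_zero _
      simp only [hker, Ideal.mem_span_singleton, LinearMap.mem_range]
      refine ⟨fun H => ?_, ?_⟩
      · choose c hc using H
        refine ⟨Finsupp.onFinset y.support c fun i hi => ?_, ?_⟩
        · rw [Finsupp.mem_support_iff, hc]
          exact fun h0 => hi (hx.right_eq_zero_of_smul h0)
        · ext i
          exact (hc i).symm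
      · rintro ⟨z, rfl⟩ i
        exact ⟨z i, rfl⟩
    refine (ModuleCat.shortComplex_shortExact (ModuleCat.shortComplexOfCompEqZero f g
      hexact.linearMap_comp_eq_zero) hexact hx.finsupp hg).hasProjectiveDimensionLT_X₃ 1 ?_ ?_
    all_goals
      have : HasProjectiveDimensionLE (ModuleCat.of A (ι →₀ A)) 0 :=
        hasProjectiveDimensionLE_zero_iff.mpr inferInstance
      exact hasProjectiveDimensionLT_of_ge (ModuleCat.of A (ι →₀ A)) 1 _ (by lia)
  induction n generalizing N with
  | zero =>
    have := hasProjectiveDimensionLE_zero_iff.mp h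
    obtain ⟨s, hs⟩ := Module.projective_def'.mp this
    have r : Retract (ModuleCat.of A N) (ModuleCat.of A (N →₀ B)) :=
      { i := ModuleCat.ofHom (s.restrictScalars A)
        r := ModuleCat.ofHom ((Finsupp.linearCombination B id).restrictScalars A)
        retract := by
          ext y
          exact DFunLike.congr_fun hs y }
    have := hfree N
    exact r.hasProjectiveDimensionLT _
  | succ n ih =>
    let g : (N →₀ B) →ₗ[B] N := Finsupp.linearCombination B id
    have hg : Function.Surjective g := Finsupp.linearCombination_id_surjective B N
    have hK := ih _ ((hasProjectiveDimensionLE_ker_iff g hg n).mpr h)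
    have := hfree N
    refine ((g.restrictScalars A).shortExact_subtype_ker hg).hasProjectiveDimensionLT_X₃ (n + 2)
      hK (hasProjectiveDimensionLT_of_ge _ 2 _ (by lia))

section EmbeddingDimension

variable {A : Type*} [CommRing A] [IsLocalRing A] {x : A}

lemma IsLocalRing.isLocalRing_quotient_span_singleton (hx : x ∈ maximalIdeal A) :
    IsLocalRing (A ⧸ Ideal.span {x}) :=
  have : Nontrivial (A ⧸ Ideal.span {x}) := Ideal.Quotient.nontrivial_iff.mpr
    fun h => (maximalIdeal.isMaximal A).ne_top
      (top_le_iff.mp (h ▸ (Ideal.span_singleton_le_iff_mem _).mpr hx))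
  .of_surjective' _ Ideal.Quotient.mk_surjective

lemma IsLocalRing.maximalIdeal_quotient_eq_map {I : Ideal A} [IsLocalRing (A ⧸ I)] :
    maximalIdeal (A ⧸ I) = (maximalIdeal A).map (Ideal.Quotient.mk I) := by
  have := IsLocalHom.of_surjective (Ideal.Quotient.mk I) Ideal.Quotient.mk_surjective
  rw [← maximalIdeal_comap (Ideal.Quotient.mk I),
    Ideal.map_comap_of_surjective _ Ideal.Quotient.mk_surjective]

variable [IsNoetherianRing A]

lemma IsLocalRing.exists_maximalIdeal_eq_span_insert (hx : x ∈ maximalIdeal A)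
    (hx2 : x ∉ maximalIdeal A ^ 2) :
    ∃ T : Set A, T.Finite ∧ T.ncard + 1 ≤ (maximalIdeal A).spanFinrank ∧
      maximalIdeal A = Ideal.span (insert x T) := by
  classical
  let v : CotangentSpace A := (maximalIdeal A).toCotangent ⟨x, hx⟩
  have hv : v ≠ 0 := fun h => hx2 ((Ideal.toCotangent_eq_zero _ _).mp h)
  have hli : LinearIndepOn (ResidueField A) id {v} := LinearIndepOn.singleton hv
  let b := Module.Basis.extend hli
  let e := hli.extend (Set.subset_univ _)
  have hve : v ∈ e := Module.Basis.subset_extend hli rfl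
  have hfin : e.Finite :=
    Set.finite_coe_iff.mp (Module.Finite.finite_basis b)
  have hcard : e.ncard = (maximalIdeal A).spanFinrank := by
    rw [spanFinrank_maximalIdeal_eq_finrank_cotangentSpace, Module.finrank_eq_nat_card_basis b]
    rfl
  let σ : CotangentSpace A → maximalIdeal A :=
    Function.update (Function.surjInv (Ideal.toCotangent_surjective _)) v ⟨x, hx⟩
  have hσ (y) : (maximalIdeal A).toCotangent (σ y) = y := by
    by_cases h : y = v
    · subst h
      simp [σ, v]
    · rw [show σ y = _ from Function.update_of_ne h _ _]
      exact Function.surjInv_eq _ y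
  have hspan : Submodule.span A (σ '' e) = ⊤ := by
    rw [← CotangentSpace.span_image_eq_top_iff, ← Set.image_comp]
    have : (maximalIdeal A).toCotangent ∘ σ = id := funext hσ
    rw [this, Set.image_id, ← b.span_eq, Module.Basis.range_extend]
  refine ⟨(fun y => (σ y : A)) '' (e \ {v}), (hfin.sdiff).image _, ?_, ?_⟩
  · rw [← hcard, ← Set.ncard_sdiff_singleton_add_one hve hfin]
    gcongr
    exact Set.ncard_image_le hfin.sdiff
  · have h1 := congrArg (Submodule.map (maximalIdeal A).subtype) hspan
    rw [Submodule.map_span, Submodule.map_top, Submodule.range_subtype, ← Set.image_comp] at h1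
    have h2 : insert x ((fun y => (σ y : A)) '' (e \ {v})) =
        (maximalIdeal A).subtype ∘ σ '' e := by
      conv_rhs => rw [← Set.insert_sdiff_self_of_mem hve, Set.image_insert_eq]
      congr 1
      simp [σ]
    rw [h2]
    exact h1.symm

lemma IsLocalRing.spanFinrank_maximalIdeal_quotient_add_one_le
    [IsLocalRing (A ⧸ Ideal.span {x})] (hx : x ∈ maximalIdeal A) (hx2 : x ∉ maximalIdeal A ^ 2) :
    (maximalIdeal (A ⧸ Ideal.span {x})).spanFinrank + 1 ≤ (maximalIdeal A).spanFinrank := by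
  obtain ⟨T, hT, hcard, hm⟩ := exists_maximalIdeal_eq_span_insert hx hx2
  refine le_trans ?_ hcard
  gcongr
  have h0 : Ideal.Quotient.mk (Ideal.span {x}) x = 0 :=
    Ideal.Quotient.eq_zero_iff_mem.mpr (Ideal.mem_span_singleton_self x)
  rw [maximalIdeal_quotient_eq_map, hm, Ideal.map_span, Set.image_insert_eq, h0,
    Ideal.span_insert_zero]
  exact (Submodule.spanFinrank_span_le_ncard_of_finite (hT.image _)).trans
    (Set.ncard_image_le hT)

lemma IsLocalRing.spanFinrank_maximalIdeal_le_quotient_add_one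
    [IsLocalRing (A ⧸ Ideal.span {x})] :
    (maximalIdeal A).spanFinrank ≤ (maximalIdeal (A ⧸ Ideal.span {x})).spanFinrank + 1 := by
  have hfg := (maximalIdeal (A ⧸ Ideal.span {x})).fg_of_isNoetherianRing
  have hfin := Submodule.FG.finite_generators hfg
  let σ := Function.surjInv (Ideal.Quotient.mk_surjective (I := Ideal.span {x}))
  let S := insert x (σ '' (maximalIdeal (A ⧸ Ideal.span {x})).generators)
  have hS : Ideal.span S = maximalIdeal A := by
    have := IsLocalHom.of_surjective (Ideal.Quotient.mk (Ideal.span {x}))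
      Ideal.Quotient.mk_surjective
    rw [← maximalIdeal_comap (Ideal.Quotient.mk (Ideal.span {x})),
      ← (maximalIdeal (A ⧸ Ideal.span {x})).span_generators, Ideal.span_insert, sup_comm]
    have h1 : Submodule.span _ (maximalIdeal (A ⧸ Ideal.span {x})).generators =
        (Ideal.span (σ '' (maximalIdeal (A ⧸ Ideal.span {x})).generators)).map
          (Ideal.Quotient.mk (Ideal.span {x})) := by
      rw [Ideal.map_span, ← Set.image_comp, show (Ideal.Quotient.mk (Ideal.span {x})) ∘ σ = id from
        funext fun y => Function.surjInv_eq _ y, Set.image_id]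
    rw [h1, Ideal.comap_map_of_surjective _ Ideal.Quotient.mk_surjective]
    congr 1
    exact Ideal.mk_ker.symm
  rw [← hS, ← Submodule.FG.generators_ncard hfg]
  refine (Submodule.spanFinrank_span_le_ncard_of_finite ((hfin.image _).insert x)).trans
    ((Set.ncard_insert_le _ _).trans ?_)
  gcongr
  exact Set.ncard_image_le hfin

/-- Prime avoidance: outside of the square of the maximal ideal, one can avoid finitely many
nonmaximal primes. -/
lemma IsLocalRing.exists_mem_maximalIdeal_notMem_sq (hA : maximalIdeal A ≠ ⊥)
    {s : Set (Ideal A)} (hs : s.Finite) (hprime : ∀ q ∈ s, q.IsPrime)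
    (hmax : maximalIdeal A ∉ s) :
    ∃ x ∈ maximalIdeal A, x ∉ maximalIdeal A ^ 2 ∧ ∀ q ∈ s, x ∉ q := by
  have hsq : maximalIdeal A ^ 2 ≠ maximalIdeal A := fun h => hA <|
    Submodule.eq_bot_of_le_smul_of_le_jacobson_bot (maximalIdeal A) _
      (maximalIdeal A).fg_of_isNoetherianRing (by rw [smul_eq_mul, ← pow_two, h])
      (jacobson_eq_maximalIdeal _ bot_ne_top).ge
  have htop : maximalIdeal A ^ 2 ≠ ⊤ := fun h =>
    (maximalIdeal.isMaximal A).ne_top (top_le_iff.mp (h ▸ Ideal.pow_le_self two_ne_zero))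
  have := (Ideal.subset_iUnion_iff_mem_of_isMaximal_of_finite (M := maximalIdeal A)
    (hs.insert (maximalIdeal A ^ 2)) (maximalIdeal A ^ 2) (maximalIdeal A ^ 2)
    (fun q hq h _ => hprime q (hq.resolve_left h)) htop htop).not.mpr (by
      rintro (h | h)
      exacts [hsq h.symm, hmax h])
  obtain ⟨x, hx, hx'⟩ := Set.not_subset.mp this
  simp only [Set.mem_iUnion, not_exists] at hx'
  exact ⟨x, hx, hx' _ (Set.mem_insert _ _), fun q hq => hx' q (Set.mem_insert_of_mem _ hq)⟩

end EmbeddingDimension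

lemma IsLocalRing.hasProjectiveDimensionLE_maximalIdeal {A : Type u} [CommRing A] [IsLocalRing A]
    {n : ℕ} (h : HasProjectiveDimensionLE (ModuleCat.of A (ResidueField A)) n) :
    HasProjectiveDimensionLE (ModuleCat.of A (maximalIdeal A)) n := by
  have h' : HasProjectiveDimensionLE (ModuleCat.of A (ResidueField A)) (n + 1) :=
    hasProjectiveDimensionLT_of_ge _ (n + 1) _ (by lia)
  have hker : LinearMap.ker (Algebra.linearMap A (ResidueField A)) = maximalIdeal A := by
    ext y
    exact residue_eq_zero_iff y
  rwa [← hasProjectiveDimensionLE_ker_iff (Algebra.linearMap A (ResidueField A)) residue_surjective,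
    hker] at h'

open Pointwise in
/-- The maximal ideal modulo a regular parameter has the residue field as a retract. -/
noncomputable def IsLocalRing.residueFieldRetract {A : Type u} [CommRing A] [IsLocalRing A]
    {x : A} [IsLocalRing (A ⧸ Ideal.span {x})] (hx : x ∈ maximalIdeal A)
    (hx2 : x ∉ maximalIdeal A ^ 2) :
    Retract (ModuleCat.of (A ⧸ Ideal.span {x}) (ResidueField (A ⧸ Ideal.span {x})))
      (ModuleCat.of (A ⧸ Ideal.span {x}) (QuotSMulTop x (maximalIdeal A))) := by
  let B := A ⧸ Ideal.span {x}
  have hlin : ∃ φ : CotangentSpace A →ₗ[ResidueField A] ResidueField A,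
      φ ((maximalIdeal A).toCotangent ⟨x, hx⟩) = 1 :=
    Module.Projective.exists_dual_eq_one _ fun h => hx2 ((Ideal.toCotangent_eq_zero _ _).mp h)
  let x' : QuotSMulTop x (maximalIdeal A) := Submodule.Quotient.mk ⟨x, hx⟩
  have hi : maximalIdeal B ≤ LinearMap.ker (LinearMap.toSpanSingleton B _ x') := by
    rw [maximalIdeal_quotient_eq_map, Ideal.map_le_iff_le_comap]
    intro a ha
    change Submodule.Quotient.mk (a • (⟨x, hx⟩ : maximalIdeal A)) = 0
    rw [Submodule.Quotient.mk_eq_zero]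
    convert Submodule.smul_mem_pointwise_smul (⟨a, ha⟩ : maximalIdeal A) x ⊤ trivial using 1
    exact Subtype.ext (mul_comm _ _)
  let i : ResidueField B →ₗ[B] QuotSMulTop x (maximalIdeal A) :=
    Submodule.liftQ (maximalIdeal B) (LinearMap.toSpanSingleton B _ x') hi
  have hi1 : i 1 = x' := one_smul B x'
  have hu : maximalIdeal A ≤ LinearMap.ker (Algebra.linearMap A (ResidueField B)) := by
    intro a ha
    refine (residue_eq_zero_iff (Ideal.Quotient.mk (Ideal.span {x}) a)).mpr ?_
    rw [maximalIdeal_quotient_eq_map]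
    exact Ideal.mem_map_of_mem _ ha
  let u : ResidueField A →ₗ[A] ResidueField B :=
    Submodule.liftQ (maximalIdeal A) (Algebra.linearMap A (ResidueField B)) hu
  have hu1 : u 1 = 1 := map_one (algebraMap A (ResidueField B))
  let w : maximalIdeal A →ₗ[A] ResidueField B :=
    u ∘ₗ hlin.choose.restrictScalars A ∘ₗ (maximalIdeal A).toCotangent
  have hw : x • (⊤ : Submodule A (maximalIdeal A)) ≤ LinearMap.ker w := by
    rintro _ ⟨y, -, rfl⟩
    change w (x • y) = 0
    have : (maximalIdeal A).toCotangent (x • y) = 0 := by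
      rw [map_smul]
      exact Ideal.Cotangent.smul_eq_zero_of_mem hx _
    rw [LinearMap.comp_apply, LinearMap.comp_apply, this, map_zero, map_zero]
  let r : QuotSMulTop x (maximalIdeal A) →ₗ[B] ResidueField B :=
    (Submodule.liftQ _ w hw).extendScalarsOfSurjective Ideal.Quotient.mk_surjective
  have hr : r x' = 1 := by
    change u (hlin.choose ((maximalIdeal A).toCotangent ⟨x, hx⟩)) = 1
    rw [hlin.choose_spec, hu1]
  exact
    { i := ModuleCat.ofHom i
      r := ModuleCat.ofHom r
      retract := by
        ext y
        obtain ⟨b, rfl⟩ := residue_surjective y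
        change r (i (residue B b)) = residue B b
        have hb : residue B b = b • (1 : ResidueField B) := (Algebra.algebraMap_eq_smul_one b)
        rw [hb, map_smul, map_smul, hi1, hr] }

lemma IsRegularLocalRing.of_maximalIdeal_eq_bot {A : Type*} [CommRing A] [IsLocalRing A]
    [IsNoetherianRing A] (h : maximalIdeal A = ⊥) : IsRegularLocalRing A := by
  apply IsRegularLocalRing.of_spanFinrank_maximalIdeal_le
  rw [h]
  simpa using ringKrullDim_nonneg_of_nontrivial (R := A)

/-- A Noetherian local ring whose residue field has finite projective dimension is regular. -/
theorem IsRegularLocalRing.of_hasProjectiveDimensionLE {A : Type u} [CommRing A] [IsLocalRing A]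
    [IsNoetherianRing A] {n : ℕ}
    (h : HasProjectiveDimensionLE (ModuleCat.of A (ResidueField A)) n) :
    IsRegularLocalRing A := by
  induction hd : (maximalIdeal A).spanFinrank using Nat.strong_induction_on generalizing A with
  | _ d ih =>
  by_cases hbot : maximalIdeal A = ⊥
  · exact .of_maximalIdeal_eq_bot hbot
  have hass : maximalIdeal A ∉ associatedPrimes A A := by
    intro hmem
    obtain ⟨-, a, ha⟩ := isAssociatedPrime_iff.mp hmem
    have hann (y : A) : y ∈ maximalIdeal A ↔ y * a = 0 := by
      rw [ha, Submodule.mem_colon_singleton, Submodule.mem_bot, smul_eq_mul]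
    have ha0 : a ≠ 0 := by
      rintro rfl
      exact (maximalIdeal.isMaximal A).ne_top
        ((Ideal.eq_top_iff_one _).mpr ((hann 1).mpr (by simp)))
    have : Nontrivial (ResidueField A) :=
      Ideal.Quotient.nontrivial_iff.mpr (maximalIdeal.isMaximal A).ne_top
    have hfree := free_of_hasProjectiveDimensionLE ha0
      (fun y hy => by rw [mul_comm]; exact (hann y).mp hy) n _ h
    refine hbot (le_bot_iff.mp fun y hy => ?_)
    rw [← (Module.annihilator_eq_bot (R := A) (M := ResidueField A)).mpr
        (Module.Free.instFaithfulSMulOfNontrivial A (ResidueField A)),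
      Module.mem_annihilator]
    intro z
    rw [Algebra.smul_def, ResidueField.algebraMap_eq, (residue_eq_zero_iff y).mpr hy, zero_mul]
  obtain ⟨x, hx, hx2, hxass⟩ := exists_mem_maximalIdeal_notMem_sq hbot (associatedPrimes.finite A A)
    (fun q hq => hq.1) hass
  have hreg : IsSMulRegular A x := by
    by_contra hnot
    have : x ∈ ⋃ q ∈ associatedPrimes A A, (q : Set A) := by
      rw [biUnion_associatedPrimes_eq_compl_regular]
      exact hnot
    simp only [Set.mem_iUnion] at this
    obtain ⟨q, hq, hxq⟩ := this
    exact hxass q hq hxq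
  have := isLocalRing_quotient_span_singleton hx
  have hpd := hasProjectiveDimensionLE_quotSMulTop hreg n _ (hreg.submodule (maximalIdeal A) x)
    (hasProjectiveDimensionLE_maximalIdeal h)
  have hB := ih _ (by
    have := spanFinrank_maximalIdeal_quotient_add_one_le hx hx2
    lia) ((residueFieldRetract hx hx2).hasProjectiveDimensionLT (n + 1)) rfl
  apply IsRegularLocalRing.of_spanFinrank_maximalIdeal_le
  rw [← ringKrullDim_quotient_span_singleton_succ_eq_ringKrullDim hreg hx,
    ← hB.spanFinrank_maximalIdeal]
  exact_mod_cast spanFinrank_maximalIdeal_le_quotient_add_one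

namespace IsRegularLocalRing

lemma quotient_span_singleton {A : Type*} [CommRing A] [IsRegularLocalRing A] {x : A}
    (hx : x ∈ maximalIdeal A) (hx2 : x ∉ maximalIdeal A ^ 2) :
    IsRegularLocalRing (A ⧸ Ideal.span {x}) := by
  have := isLocalRing_quotient_span_singleton hx
  apply of_spanFinrank_maximalIdeal_le
  have h1 := spanFinrank_maximalIdeal_quotient_add_one_le hx hx2
  have h2 := ringKrullDim_le_ringKrullDim_quotient_add_card {x} (by
    rw [ringJacobson_eq_maximalIdeal]
    simpa using hx)
  rw [Finset.coe_singleton, Finset.card_singleton, ← spanFinrank_maximalIdeal] at h2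
  have h3 := le_trans (Nat.cast_le (α := WithBot ℕ∞).mpr h1) h2
  push_cast at h3
  exact ENat.WithBot.add_le_add_one_right_iff.mp h3

lemma maximalIdeal_notMem_minimalPrimes {A : Type*} [CommRing A] [IsRegularLocalRing A]
    (h : maximalIdeal A ≠ ⊥) : maximalIdeal A ∉ minimalPrimes A := by
  intro hmem
  have h0 := Ideal.height_eq_zero_iff.mpr hmem
  have h1 := spanFinrank_maximalIdeal (R := A)
  rw [← maximalIdeal_height_eq_ringKrullDim, h0] at h1
  refine h ((Submodule.spanFinrank_eq_zero_iff_eq_bot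
    (maximalIdeal A).fg_of_isNoetherianRing).mp ?_)
  exact_mod_cast h1

theorem isDomain (A : Type*) [CommRing A] [IsRegularLocalRing A] : IsDomain A := by
  induction hd : (maximalIdeal A).spanFinrank using Nat.strong_induction_on generalizing A with
  | _ d ih =>
  by_cases hbot : maximalIdeal A = ⊥
  · exact (isField_iff_maximalIdeal_eq.mpr hbot).isDomain
  obtain ⟨x, hx, hx2, hmin⟩ := exists_mem_maximalIdeal_notMem_sq hbot
    (minimalPrimes.finite_of_isNoetherianRing A) (fun q hq => hq.1.1)
    (maximalIdeal_notMem_minimalPrimes hbot)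
  have := quotient_span_singleton hx hx2
  have hdom := ih _ (by
    have := spanFinrank_maximalIdeal_quotient_add_one_le hx hx2
    lia) (A ⧸ Ideal.span {x}) rfl
  have hprime := (Ideal.Quotient.isDomain_iff_prime _).mp hdom
  obtain ⟨q, hq, hqx⟩ := Ideal.exists_minimalPrimes_le (bot_le (a := Ideal.span {x}))
  have := hq.1.1
  have hq0 : q = ⊥ := by
    refine Submodule.eq_bot_of_le_smul_of_le_jacobson_bot (Ideal.span {x}) q
      q.fg_of_isNoetherianRing (fun y hy => ?_) ?_
    · obtain ⟨z, rfl⟩ := Ideal.mem_span_singleton.mp (hqx hy)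
      exact Ideal.mul_mem_mul (Ideal.mem_span_singleton_self x)
        ((this.mem_or_mem hy).resolve_left (hmin q hq))
    · rw [jacobson_eq_maximalIdeal _ bot_ne_top]
      exact (Ideal.span_singleton_le_iff_mem _).mpr hx
  subst hq0
  exact IsDomain.of_bot_isPrime A

/-- Finite modules over a regular local ring have finite projective dimension. -/
theorem exists_hasProjectiveDimensionLE {A : Type u} [CommRing A] [IsRegularLocalRing A]
    (M : Type u) [AddCommGroup M] [Module A M] [Module.Finite A M] :
    ∃ n, HasProjectiveDimensionLE (ModuleCat.of A M) n := by
  induction hd : (maximalIdeal A).spanFinrank using Nat.strong_induction_on generalizing A M with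
  | _ d ih =>
  obtain ⟨ι, _, g, hg, hker⟩ := exists_surjective_ker_apply_mem_maximalIdeal A M
  by_cases hbot : maximalIdeal A = ⊥
  · refine ⟨0, hasProjectiveDimensionLE_zero_iff.mpr
      (Module.Projective.of_equiv (LinearEquiv.ofBijective g ⟨?_, hg⟩))⟩
    refine LinearMap.ker_eq_bot.mp (le_bot_iff.mp fun y hy => ?_)
    ext i
    simpa [hbot] using hker y hy i
  obtain ⟨x, hx, hx2, -⟩ := exists_mem_maximalIdeal_notMem_sq hbot Set.finite_empty
    (by simp) (by simp)
  have := isDomain A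
  have hx0 : x ≠ 0 := by
    rintro rfl
    exact hx2 (zero_mem _)
  have hreg : IsSMulRegular A x := (IsRegular.of_ne_zero hx0).left.isSMulRegular
  have := quotient_span_singleton hx hx2
  have := Module.Finite.of_restrictScalars_finite A (A ⧸ Ideal.span {x})
    (QuotSMulTop x (LinearMap.ker g))
  obtain ⟨n, hn⟩ := ih _ (by
    have := spanFinrank_maximalIdeal_quotient_add_one_le hx hx2
    lia) (A := A ⧸ Ideal.span {x}) (QuotSMulTop x (LinearMap.ker g)) rfl
  have h1 := hasProjectiveDimensionLE_of_quotient hreg n _ hn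
  have hregK : IsSMulRegular (LinearMap.ker g) x :=
    (hreg.finsupp (α := ι)).submodule (LinearMap.ker g) x
  have h2 := ModuleCat.projectiveDimension_quotSMulTop_eq_succ_of_isSMulRegular
    (ModuleCat.of A (LinearMap.ker g)) x hregK hx
  have h3 : projectiveDimension (ModuleCat.of A (LinearMap.ker g)) ≠ ⊤ := by
    intro h
    rw [h] at h2
    exact (projectiveDimension_ne_top_iff _).mpr ⟨_, h1⟩ h2
  obtain ⟨k, hk⟩ := (projectiveDimension_ne_top_iff _).mp h3
  exact ⟨k + 1, (hasProjectiveDimensionLE_ker_iff g hg k).mp hk⟩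

end IsRegularLocalRing

section FiniteGlobal

variable {R : Type u} [CommRing R]

theorem ModuleCat.finite_localizedModule (M : ModuleCat.{u} R) [Module.Finite R M]
    (S : Submonoid R) : Module.Finite (Localization S) (M.localizedModule S) :=
  Module.Finite.of_isLocalizedModule S (M.localizedModuleMkLinearMap S)

variable [IsNoetherianRing R]

/-- Over a Noetherian ring, the set of primes at which a finite module has projective dimension
at most `n` is open. -/
theorem ModuleCat.isOpen_setOf_hasProjectiveDimensionLE_localizedModule (n : ℕ)
    (M : ModuleCat.{u} R) [Module.Finite R M] :
    IsOpen {q : PrimeSpectrum R |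
      HasProjectiveDimensionLE (M.localizedModule q.asIdeal.primeCompl) n} := by
  induction n generalizing M with
  | zero =>
    have : Module.FinitePresentation R M := Module.finitePresentation_of_finite R M
    convert Module.isOpen_freeLocus (R := R) (M := M) using 1
    ext q
    have := M.finite_localizedModule q.asIdeal.primeCompl
    rw [Module.mem_freeLocus_of_isLocalization q (Localization.AtPrime q.asIdeal) _
      (M.localizedModuleMkLinearMap q.asIdeal.primeCompl)]
    refine (hasProjectiveDimensionLE_zero_iff (A := Localization.AtPrime q.asIdeal)
      (M := M.localizedModule q.asIdeal.primeCompl)).trans ⟨fun h ↦ ?_, fun h ↦ ?_⟩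
    · have : Module.Finite (Localization.AtPrime q.asIdeal)
        (M.localizedModule q.asIdeal.primeCompl) := this
      exact Module.free_of_flat_of_isLocalRing
    · exact Module.Projective.of_free
  | succ n ih =>
    obtain ⟨P, _, _, _, _, f, hf⟩ := Module.exists_finite_presentation R M
    have hS := LinearMap.shortExact_shortComplexKer hf
    have proj := ModuleCat.projective_of_categoryTheory_projective f.shortComplexKer.X₂
    convert ih (ModuleCat.of R (LinearMap.ker f)) using 1
    ext q
    exact (hS.map_of_exact
      (ModuleCat.localizedModuleFunctor q.asIdeal.primeCompl)).hasProjectiveDimensionLT_X₃_iff n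
        ((ModuleCat.localizedModuleFunctor.{u}
          q.asIdeal.primeCompl).projective_obj_of_projective proj)

/-- A finite module over a Noetherian ring all of whose localizations at primes are regular
has finite projective dimension. -/
theorem ModuleCat.exists_hasProjectiveDimensionLE_of_forall_isRegularLocalRing
    (h : ∀ q : PrimeSpectrum R, IsRegularLocalRing (Localization.AtPrime q.asIdeal))
    (M : ModuleCat.{u} R) [Module.Finite R M] : ∃ n, HasProjectiveDimensionLE M n := by
  obtain ⟨n, hn⟩ := isCompact_univ.elim_directed_cover
    (fun n : ℕ ↦ {q : PrimeSpectrum R |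
      HasProjectiveDimensionLE (M.localizedModule q.asIdeal.primeCompl) n})
    (fun n ↦ M.isOpen_setOf_hasProjectiveDimensionLE_localizedModule n)
    (fun q _ ↦ by
      have := h q
      have := M.finite_localizedModule q.asIdeal.primeCompl
      obtain ⟨n, hn⟩ := IsRegularLocalRing.exists_hasProjectiveDimensionLE
        (A := Localization.AtPrime q.asIdeal) (M.localizedModule q.asIdeal.primeCompl)
      exact Set.mem_iUnion.mpr ⟨n, hn⟩)
    (directed_of_isDirected_le fun m n hmn q (hq : HasProjectiveDimensionLE _ m) ↦
      hasProjectiveDimensionLT_of_ge _ (m + 1) (n + 1) (by lia))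
  exact ⟨n, (M.hasProjectiveDimensionLE_iff_forall_primeSpectrum n).mpr
    fun q ↦ hn (Set.mem_univ q)⟩

end FiniteGlobal

section ResidueFieldLocalization

variable {B : Type u} [CommRing B]

/-- The localization of `B ⧸ P` at the prime `P` is the residue field of the local ring `B_P`. -/
theorem nonempty_linearEquiv_residueField_localizedModule (P : Ideal B) [P.IsPrime]
    (S : Submonoid B) (hS : S = P.primeCompl) [IsLocalRing (Localization S)] :
    Nonempty (LocalizedModule S (B ⧸ P) ≃ₗ[Localization S] ResidueField (Localization S)) := by
  subst hS
  let g := LinearMap.toSpanSingleton (Localization P.primeCompl)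
    (LocalizedModule P.primeCompl (B ⧸ P)) (LocalizedModule.mk 1 1)
  have hg (b : B) (s : P.primeCompl) : g (Localization.mk b s) =
      LocalizedModule.mk (Ideal.Quotient.mk P b) s := by
    simp only [g, LinearMap.toSpanSingleton_apply, LocalizedModule.mk_smul_mk, mul_one]
    congr 1
    rw [Algebra.smul_def, mul_one]; rfl
  have hsurj : Function.Surjective g := fun y ↦ by
    induction y using LocalizedModule.induction_on with | _ m s
    obtain ⟨b, rfl⟩ := Ideal.Quotient.mk_surjective m
    exact ⟨_, hg b s⟩
  have hker : LinearMap.ker g = maximalIdeal (Localization P.primeCompl) := by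
    ext x
    induction x using Localization.induction_on with | _ y
    obtain ⟨b, s⟩ := y
    rw [LinearMap.mem_ker, hg, Localization.mk_eq_mk',
      IsLocalization.AtPrime.mk'_mem_maximal_iff (Localization.AtPrime P) P,
      IsLocalizedModule.mk_eq_mk', IsLocalizedModule.mk'_eq_zero']
    have hsmul (t : P.primeCompl) : t • Ideal.Quotient.mk P b = 0 ↔ b ∈ P := by
      rw [show t • Ideal.Quotient.mk P b = Ideal.Quotient.mk P (t * b) from rfl,
        Ideal.Quotient.eq_zero_iff_mem, Ideal.IsPrime.mul_mem_left_iff t.2]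
    exact ⟨fun ⟨t, ht⟩ ↦ (hsmul t).mp ht, fun hb ↦ ⟨1, (hsmul 1).mpr hb⟩⟩
  exact ⟨(g.quotKerEquivOfSurjective hsurj).symm.trans (Submodule.quotEquivOfEq _ _ hker)⟩

end ResidueFieldLocalization

theorem isRegLocal_of_isRegularLocalRing (A : Type) [CommRing A] [IsRegularLocalRing A] :
    IsRegLocal A :=
  ⟨inferInstance, inferInstance,
    (IsRegularLocalRing.iff_finrank_cotangentSpace A).mp inferInstance⟩

theorem IsRegLocal.isRegularLocalRing {A : Type} [CommRing A] (h : IsRegLocal A) :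
    IsRegularLocalRing A := by
  obtain ⟨_, _, h⟩ := h
  exact (IsRegularLocalRing.iff_finrank_cotangentSpace A).mpr h

theorem imageSubmonoidI_eq_primeCompl (R : Type) [CommRing R] (I p : Ideal R) [p.IsPrime]
    (hIp : I ≤ p) [(p.map (Ideal.Quotient.mk I)).IsPrime] :
    imageSubmonoidI R I p = (p.map (Ideal.Quotient.mk I)).primeCompl := by
  have hmem (r : R) : Ideal.Quotient.mk I r ∈ p.map (Ideal.Quotient.mk I) ↔ r ∈ p := by
    rw [← Ideal.mem_comap, Ideal.comap_map_of_surjective' _ Ideal.Quotient.mk_surjective,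
      Ideal.mk_ker, sup_eq_left.mpr hIp]
  ext x
  constructor
  · rintro ⟨r, hr, rfl⟩
    exact (hmem r).not.mpr hr
  · intro hx
    obtain ⟨r, rfl⟩ := Ideal.Quotient.mk_surjective x
    exact ⟨r, (hmem r).not.mp hx, rfl⟩

/-- If all localizations of the Noetherian ring `R` at primes are regular, then every finite
`R ⧸ I`-module has finite projective dimension over `R`. -/
theorem hasFinProjDim_compHom_of_forall_isRegLocal {R : Type} [CommRing R] [IsNoetherianRing R]
    (hreg : ∀ p : PrimeSpectrum R, IsRegLocal (Localization.AtPrime p.asIdeal)) (I : Ideal R)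
    (M : Type) [AddCommGroup M] [Module (R ⧸ I) M] [Module.Finite (R ⧸ I) M] :
    letI : Module R M := Module.compHom M (Ideal.Quotient.mk I)
    HasFinProjDim R M := by
  let : Module R M := Module.compHom M (Ideal.Quotient.mk I)
  have : IsScalarTower R (R ⧸ I) M := IsScalarTower.of_algebraMap_smul fun _ _ ↦ rfl
  have : Module.Finite R M := Module.Finite.trans (R ⧸ I) M
  exact hasFinProjDim_iff.mpr
    (ModuleCat.exists_hasProjectiveDimensionLE_of_forall_isRegularLocalRing
      (fun q ↦ (hreg q).isRegularLocalRing) (ModuleCat.of R M))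

theorem stmt7 (R : Type) [CommRing R] [IsNoetherianRing R]
    (hreg : ∀ p : PrimeSpectrum R, IsRegLocal (Localization.AtPrime p.asIdeal))
    (I : Ideal R) (p : PrimeSpectrum R) (hIp : I ≤ p.asIdeal)
    (hnotreg : ¬ IsRegLocal (Localization (imageSubmonoidI R I p.asIdeal))) :
    ∃ (M : Type) (_ : AddCommGroup M) (_ : Module (R ⧸ I) M),
      Module.Finite (R ⧸ I) M ∧
      ¬ HasFinProjDim (Localization (imageSubmonoidI R I p.asIdeal))
          (LocalizedModule (imageSubmonoidI R I p.asIdeal) M) ∧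
      (letI : Module R M := Module.compHom M (Ideal.Quotient.mk I);
        HasFinProjDim R M) := by
  have hP : (p.asIdeal.map (Ideal.Quotient.mk I)).IsPrime :=
    Ideal.map_isPrime_of_surjective Ideal.Quotient.mk_surjective (by rwa [Ideal.mk_ker])
  refine ⟨(R ⧸ I) ⧸ p.asIdeal.map (Ideal.Quotient.mk I), inferInstance, inferInstance,
    inferInstance, fun h ↦ hnotreg ?_, ?_⟩
  · have hS := imageSubmonoidI_eq_primeCompl R I p.asIdeal hIp
    have : IsLocalRing (Localization (imageSubmonoidI R I p.asIdeal)) := by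
      rw [hS]
      exact Localization.AtPrime.isLocalRing (R := R ⧸ I) _
    have : IsNoetherianRing (Localization (imageSubmonoidI R I p.asIdeal)) :=
      IsLocalization.isNoetherianRing (imageSubmonoidI R I p.asIdeal) _ inferInstance
    obtain ⟨n, hn⟩ := hasFinProjDim_iff.mp h
    obtain ⟨e⟩ := nonempty_linearEquiv_residueField_localizedModule
      (p.asIdeal.map (Ideal.Quotient.mk I)) _ hS
    have := IsRegularLocalRing.of_hasProjectiveDimensionLE
      (hasProjectiveDimensionLT_of_iso e.toModuleIso (n + 1))
    exact isRegLocal_of_isRegularLocalRing _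
  · exact hasFinProjDim_compHom_of_forall_isRegLocal hreg I _
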